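/- For every integer n ≥ 1, the triple sum U_3(n) in ℚ(q) satisfies: U_3(n) = 0 if n = 2k-1 is odd, and U_3(n) = ((-1)^{k-1}/2) q^{9k^2+3k} if n = 2k is even. -/

import Mathlib

open Finset

noncomputable def q : RatFunc ℚ := RatFunc.X

noncomputable def qPoch (a : RatFunc ℚ) (n : ℕ) : RatFunc ℚ :=
  ∏ k ∈ Finset.range n, (1 - a * q ^ k)

noncomputable def qPochZ (a : RatFunc ℚ) (n : ℤ) : RatFunc ℚ :=
  if 0 ≤ n then qPoch a n.toNat else 1 / qPoch (a * q ^ n) (-n).toNat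

noncomputable def qbinom (n m : ℤ) : RatFunc ℚ :=
  if 0 ≤ m ∧ m ≤ n then
    qPoch q n.toNat / (qPoch q m.toNat * qPoch q (n - m).toNat)
  else 0

/-- The multiple sum `U_m(n)`, with the cyclic convention `r_{m+1} = r_1`. -/
noncomputable def Umul (m : ℕ) [NeZero m] (n : ℕ) : RatFunc ℚ :=
  ∑ r ∈ Fintype.piFinset (fun _ : Fin m => Finset.range (2 * n + 2)),
    ∏ k : Fin m,
      ((-1 : RatFunc ℚ) ^ r k * q ^ (r k * (r k - 1) / 2) *
        qPochZ (-q) ((n : ℤ) - r k) * qbinom (2 * (n : ℤ) - r k + 1) (r (k + 1)))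

/-- The multiple sum `W_m(n)`, with the cyclic convention `r_{m+1} = r_1`. -/
noncomputable def Wmul (m : ℕ) [NeZero m] (n : ℕ) : RatFunc ℚ :=
  ∑ r ∈ Fintype.piFinset (fun _ : Fin m => Finset.range (2 * n + 1)),
    ∏ k : Fin m,
      ((-1 : RatFunc ℚ) ^ r k * q ^ (r k * (r k - 1) / 2) *
        qPochZ (-q) ((n : ℤ) - r k) * qbinom (2 * (n : ℤ) - r k) (r (k + 1)))

lemma q_ne_zero : q ≠ 0 := RatFunc.X_ne_zero

lemma one_sub_q_pow_ne_zero {k : ℕ} (hk : 0 < k) : 1 - q ^ k ≠ 0 := by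
  have h : (1 - Polynomial.X ^ k : Polynomial ℚ) ≠ 0 := by
    intro h
    have := congrArg (Polynomial.eval 0) h
    simp [hk.ne'] at this
  have h2 := (map_ne_zero_iff _ (RatFunc.algebraMap_injective ℚ)).mpr h
  simpa [q, RatFunc.algebraMap_X] using h2

lemma one_add_q_pow_ne_zero (k : ℕ) : 1 + q ^ k ≠ 0 := by
  have h : (1 + Polynomial.X ^ k : Polynomial ℚ) ≠ 0 := by
    intro h
    have := congrArg (Polynomial.eval 1) h
    norm_num at this
  have h2 := (map_ne_zero_iff _ (RatFunc.algebraMap_injective ℚ)).mpr h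
  simpa [q, RatFunc.algebraMap_X] using h2

lemma one_add_q_zpow_ne_zero (z : ℤ) : 1 + q ^ z ≠ 0 := by
  obtain ⟨k, rfl | rfl⟩ := z.eq_nat_or_neg
  · simpa using one_add_q_pow_ne_zero k
  · have h : 1 + q ^ (-(k : ℤ)) = q ^ (-(k : ℤ)) * (1 + q ^ k) := by
      rw [mul_add, mul_one, zpow_neg, zpow_natCast,
        inv_mul_cancel₀ (pow_ne_zero _ q_ne_zero), add_comm]
    rw [h]
    exact mul_ne_zero (zpow_ne_zero _ q_ne_zero) (one_add_q_pow_ne_zero k)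

lemma qPoch_q_ne_zero (n : ℕ) : qPoch q n ≠ 0 := by
  rw [qPoch, Finset.prod_ne_zero_iff]
  intro k _
  simpa [pow_succ'] using one_sub_q_pow_ne_zero k.succ_pos

lemma qPoch_q_succ (n : ℕ) : qPoch q (n + 1) = qPoch q n * (1 - q ^ (n + 1)) := by
  rw [qPoch, Finset.prod_range_succ, ← qPoch, pow_succ']

/-- The reciprocal `1 / (q;q)_m`, extended by zero to negative `m`. -/
noncomputable def qPochInv (m : ℤ) : RatFunc ℚ := if 0 ≤ m then (qPoch q m.toNat)⁻¹ else 0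

lemma qPochInv_natCast (m : ℕ) : qPochInv m = (qPoch q m)⁻¹ := by simp [qPochInv]

lemma qPochInv_of_neg {m : ℤ} (hm : m < 0) : qPochInv m = 0 := by simp [qPochInv, hm]

lemma qPochInv_sub_one (m : ℤ) : qPochInv (m - 1) = (1 - q ^ m) * qPochInv m := by
  rcases lt_trichotomy m 0 with h | rfl | h
  · rw [qPochInv_of_neg h, qPochInv_of_neg (by omega), mul_zero]
  · rw [qPochInv_of_neg (by omega)]; simp
  · obtain ⟨k, rfl⟩ : ∃ k : ℕ, m = (k + 1 : ℕ) := ⟨(m - 1).toNat, by omega⟩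
    rw [show ((k + 1 : ℕ) : ℤ) - 1 = (k : ℕ) by push_cast; ring, qPochInv_natCast, qPochInv_natCast,
      qPoch_q_succ, zpow_natCast]
    have h1 := one_sub_q_pow_ne_zero k.succ_pos
    have h2 := qPoch_q_ne_zero k
    field_simp

lemma qbinom_natCast_left (a : ℕ) (b : ℤ) :
    qbinom a b = qPoch q a * qPochInv b * qPochInv (a - b) := by
  unfold qbinom
  split_ifs with h
  · simp only [qPochInv, h.1, sub_nonneg, h.2, if_true, Int.toNat_natCast, div_eq_mul_inv, mul_inv]
    ring
  · rcases not_and_or.mp h with h | h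
    · rw [qPochInv_of_neg (not_le.mp h)]; ring
    · rw [qPochInv_of_neg (m := a - b) (by omega)]; ring

lemma qbinom_of_neg {a b : ℤ} (hb : b < 0) : qbinom a b = 0 := by
  simp [qbinom, hb.not_ge]

lemma qbinom_of_lt {a b : ℤ} (hb : a < b) : qbinom a b = 0 := by
  simp [qbinom, hb.not_ge]

lemma qbinom_symm (a b : ℤ) : qbinom a (a - b) = qbinom a b := by
  rcases lt_or_ge a 0 with ha | ha
  · have h (c : ℤ) : qbinom a c = 0 := by
      unfold qbinom
      rw [if_neg (by omega)]
    rw [h, h]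
  · lift a to ℕ using ha
    rw [qbinom_natCast_left, qbinom_natCast_left, sub_sub_cancel]
    ring

/-- The `q`-Pascal rule. -/
lemma qbinom_succ (a : ℕ) (b : ℤ) :
    qbinom (a + 1) b = qbinom a b + q ^ ((a : ℤ) + 1 - b) * qbinom a (b - 1) := by
  have h := qbinom_natCast_left (a + 1) b
  push_cast at h
  rw [h, qbinom_natCast_left, qbinom_natCast_left, qPochInv_sub_one,
    show (a : ℤ) - (b - 1) = a + 1 - b by ring, show (a : ℤ) - b = a + 1 - b - 1 by ring,
    qPochInv_sub_one, qPoch_q_succ, zpow_sub₀ q_ne_zero]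
  have h2 : q ^ (a + 1) = q ^ ((a : ℤ) + 1) := by exact_mod_cast rfl
  have h3 := zpow_ne_zero b q_ne_zero
  rw [h2]
  field_simp
  ring

/-- The other `q`-Pascal rule. -/
lemma qbinom_succ_right (a : ℕ) (b : ℤ) :
    qbinom (a + 1) b = qbinom a (b - 1) + q ^ b * qbinom a b := by
  have h := qbinom_succ a (a + 1 - b)
  rw [qbinom_symm, sub_sub_cancel, show (a : ℤ) + 1 - b = a - (b - 1) by ring, qbinom_symm,
    show (a : ℤ) - (b - 1) - 1 = a - b by ring, qbinom_symm] at h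
  exact h

/-- Trinomial revision. -/
lemma qbinom_mul_qbinom (a m s : ℕ) (hs : s ≤ a) :
    qbinom a s * qbinom ((a : ℤ) - s) (m - s) = qbinom a m * qbinom m s := by
  obtain ⟨d, rfl⟩ := Nat.exists_eq_add_of_le hs
  rw [show ((s + d : ℕ) : ℤ) - s = (d : ℕ) by push_cast; ring]
  simp only [qbinom_natCast_left]
  rw [show ((s + d : ℕ) : ℤ) - s = (d : ℕ) by push_cast; ring,
    show (d : ℤ) - (m - s) = (s + d : ℕ) - m by push_cast; ring,
    qPochInv_natCast d, qPochInv_natCast m]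
  have h1 := qPoch_q_ne_zero d
  have h2 := qPoch_q_ne_zero m
  field_simp

lemma q_pow_choose_two_succ (s : ℕ) : q ^ (s + 1).choose 2 = q ^ s.choose 2 * q ^ s := by
  rw [Nat.choose_succ_succ', Nat.choose_one_right, add_comm, pow_add]

lemma q_pow_choose_two_add (a b : ℕ) :
    q ^ (a + b).choose 2 = q ^ a.choose 2 * q ^ b.choose 2 * q ^ (a * b) := by
  induction b with
  | zero => simp
  | succ b ih => rw [← add_assoc, q_pow_choose_two_succ, ih, q_pow_choose_two_succ]; ring

/-- A form of the `q`-Chu–Vandermonde sum. -/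
lemma sum_qbinom_mul_qbinom_sub (t : ℤ) (m : ℕ) :
    ∀ (B : ℕ) (N : ℤ), m < B → (m : ℤ) ≤ N →
      ∑ s ∈ range B, (-1) ^ s * q ^ s.choose 2 * qbinom m s * qbinom (N - s) t =
        q ^ ((m : ℤ) * (N - t)) * qbinom (N - m) (N - t) := by
  induction m with
  | zero =>
    intro B N hB hN
    obtain ⟨B, rfl⟩ : ∃ b, B = b + 1 := ⟨B - 1, by omega⟩
    rw [Finset.sum_range_succ', Finset.sum_eq_zero]
    · simp [qbinom_symm]
      simp [qbinom, qPoch]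
    · intro s _
      rw [qbinom_of_lt (a := ((0 : ℕ) : ℤ)) (by push_cast; omega)]; ring
  | succ m ih =>
    intro B N hB hN
    obtain ⟨B, rfl⟩ : ∃ b, B = b + 1 := ⟨B - 1, by omega⟩
    obtain ⟨d, rfl⟩ : ∃ d : ℕ, N = m + 1 + d := ⟨(N - m - 1).toNat, by omega⟩
    have h1 := ih (B + 1) (m + 1 + d) (by omega) (by omega)
    have h2 := ih B (m + d) (by omega) (by omega)
    have h3 : ∀ s ∈ range (B + 1), (-1) ^ s * q ^ s.choose 2 * qbinom (m + 1 : ℕ) s *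
        qbinom ((m : ℤ) + 1 + d - s) t =
        (-1) ^ s * q ^ s.choose 2 * qbinom m s * qbinom ((m : ℤ) + 1 + d - s) t +
        (-1) ^ s * q ^ s.choose 2 * q ^ ((m : ℤ) + 1 - s) * qbinom m (s - 1) *
          qbinom ((m : ℤ) + 1 + d - s) t := by
      intro s _
      push_cast
      rw [qbinom_succ]
      ring
    have h4 : ∀ s ∈ range B, (-1) ^ (s + 1) * q ^ (s + 1).choose 2 *
        q ^ ((m : ℤ) + 1 - (s + 1 : ℕ)) * qbinom m ((s + 1 : ℕ) - 1) *
          qbinom ((m : ℤ) + 1 + d - (s + 1 : ℕ)) t =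
        -q ^ m * ((-1) ^ s * q ^ s.choose 2 * qbinom m s * qbinom ((m : ℤ) + d - s) t) := by
      intro s _
      have h5 : q ^ s * q ^ ((m : ℤ) + 1 - (s + 1 : ℕ)) = q ^ m := by
        rw [← zpow_natCast, ← zpow_add₀ q_ne_zero, ← zpow_natCast]
        congr 1; push_cast; ring
      rw [q_pow_choose_two_succ, ← h5]
      push_cast
      rw [show (m : ℤ) + 1 + d - (s + 1) = m + d - s by ring, add_sub_cancel_right]
      ring
    rw [Finset.sum_congr rfl h3, Finset.sum_add_distrib, h1, Finset.sum_range_succ',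
      Finset.sum_congr rfl h4, ← Finset.mul_sum, h2]
    rw [Nat.cast_zero, zero_sub, qbinom_of_neg (b := -1) (by norm_num)]
    have h6 := qbinom_succ_right d (m + 1 + d - t)
    rw [show (m : ℤ) + 1 + d - m = d + 1 by ring, h6]
    push_cast
    rw [show (m : ℤ) + d - m = d by ring, show (m : ℤ) + 1 + d - (m + 1) = d by ring,
      show (m : ℤ) + 1 + d - t - 1 = m + d - t by ring,
      add_one_mul, zpow_add₀ q_ne_zero ((m : ℤ) * _),
      show (m : ℤ) * (m + 1 + d - t) = m * (m + d - t) + m by ring,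
      zpow_add₀ q_ne_zero ((m : ℤ) * _), zpow_natCast]
    ring

/-- The `q`-binomial theorem. -/
lemma prod_one_add_mul_q_pow (z : RatFunc ℚ) (R : ℕ) :
    ∀ B : ℕ, R < B → ∏ i ∈ range R, (1 + z * q ^ i) =
      ∑ l ∈ range B, qbinom R l * q ^ l.choose 2 * z ^ l := by
  induction R with
  | zero =>
    intro B hB
    obtain ⟨B, rfl⟩ : ∃ b, B = b + 1 := ⟨B - 1, by omega⟩
    rw [Finset.sum_range_succ', Finset.sum_eq_zero]
    · simp [qbinom, qPoch]
    · intro s _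
      rw [qbinom_of_lt (a := ((0 : ℕ) : ℤ)) (by push_cast; omega)]; ring
  | succ R ih =>
    intro B hB
    obtain ⟨B, rfl⟩ : ∃ b, B = b + 1 := ⟨B - 1, by omega⟩
    have h3 : ∀ l ∈ range (B + 1), qbinom (R + 1 : ℕ) l * q ^ l.choose 2 * z ^ l =
        qbinom R l * q ^ l.choose 2 * z ^ l +
        q ^ ((R : ℤ) + 1 - l) * qbinom R (l - 1) * q ^ l.choose 2 * z ^ l := by
      intro l _
      push_cast
      rw [qbinom_succ]
      ring
    have h4 : ∀ l ∈ range B, q ^ ((R : ℤ) + 1 - (l + 1 : ℕ)) * qbinom R ((l + 1 : ℕ) - 1) *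
        q ^ (l + 1).choose 2 * z ^ (l + 1) =
        z * q ^ R * (qbinom R l * q ^ l.choose 2 * z ^ l) := by
      intro l _
      have h5 : q ^ l * q ^ ((R : ℤ) + 1 - (l + 1 : ℕ)) = q ^ R := by
        rw [← zpow_natCast, ← zpow_add₀ q_ne_zero, ← zpow_natCast]
        congr 1; push_cast; ring
      rw [q_pow_choose_two_succ, ← h5]
      push_cast
      rw [add_sub_cancel_right]
      ring
    rw [Finset.sum_congr rfl h3, Finset.sum_add_distrib, ← ih (B + 1) (by omega),
      Finset.sum_range_succ', Finset.sum_congr rfl h4, ← Finset.mul_sum, ← ih B (by omega),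
      Nat.cast_zero, zero_sub, qbinom_of_neg (b := -1) (by norm_num), Finset.prod_range_succ]
    ring

/-- The `q`-binomial theorem with the summation index shifted by `s`. -/
lemma prod_one_add_mul_q_pow_shift (z : RatFunc ℚ) {s R B : ℕ} (hs : s ≤ R) (hR : R < B) :
    ∏ i ∈ range (R - s), (1 + z * q ^ i) =
      ∑ m ∈ range B, qbinom ((R : ℤ) - s) ((m : ℤ) - s) * q ^ (m - s).choose 2 * z ^ (m - s) := by
  obtain ⟨d, rfl⟩ := Nat.exists_eq_add_of_le hs
  obtain ⟨b, rfl⟩ : ∃ b, B = s + b := ⟨B - s, by omega⟩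
  rw [Finset.sum_range_add, Finset.sum_eq_zero (s := range s), zero_add,
    prod_one_add_mul_q_pow z _ b (by omega)]
  · refine Finset.sum_congr rfl fun l _ => ?_
    rw [add_tsub_cancel_left, add_tsub_cancel_left]
    push_cast
    rw [add_sub_cancel_left, add_sub_cancel_left]
  · intro m hm
    rw [Finset.mem_range] at hm
    rw [qbinom_of_neg (by omega)]; ring

lemma qPochZ_zero : qPochZ (-q) 0 = 1 := by simp [qPochZ, qPoch]

lemma qPochZ_add_one (z : ℤ) : qPochZ (-q) (z + 1) = qPochZ (-q) z * (1 + q ^ (z + 1)) := by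
  rcases lt_or_ge z 0 with hz | hz
  · obtain ⟨k, rfl⟩ : ∃ k : ℕ, z = -(k + 1) := ⟨(-z - 1).toNat, by omega⟩
    have hpoch (k : ℕ) : qPochZ (-q) (-k) = (∏ i ∈ range k, (1 + q ^ (1 - (k : ℤ) + i)))⁻¹ := by
      have h (i : ℕ) : 1 - -q * q ^ (-(k : ℤ)) * q ^ i = 1 + q ^ (1 - (k : ℤ) + i) := by
        rw [zpow_add₀ q_ne_zero, sub_eq_add_neg (1 : ℤ), zpow_add₀ q_ne_zero, zpow_one,
          zpow_natCast]
        ring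
      rcases Nat.eq_zero_or_pos k with rfl | hk
      · simp [qPochZ, qPoch]
      · simp only [qPochZ, qPoch, h]
        rw [if_neg (by omega), neg_neg, Int.toNat_natCast, one_div]
    have h := hpoch (k + 1)
    push_cast at h
    rw [h, show -((k : ℤ) + 1) + 1 = -k by ring, hpoch, Finset.prod_range_succ', mul_inv]
    have h1 := one_add_q_zpow_ne_zero (-k)
    push_cast
    rw [show 1 - ((k : ℤ) + 1) + 0 = -k by ring, inv_mul_cancel_right₀ h1]
    congr 1
    refine Finset.prod_congr rfl fun i _ => ?_
    congr 2; ring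
  · lift z to ℕ using hz
    have h1 : q ^ ((z : ℤ) + 1) = q ^ (z + 1) := by exact_mod_cast rfl
    rw [qPochZ, qPochZ, if_pos (by omega), if_pos (by omega), h1, Int.toNat_natCast,
      show ((z : ℤ) + 1).toNat = z + 1 by omega, qPoch, Finset.prod_range_succ, ← qPoch]
    ring

lemma qPochZ_add_natCast (z : ℤ) (d : ℕ) :
    qPochZ (-q) (z + d) = qPochZ (-q) z * ∏ i ∈ range d, (1 + q ^ (z + 1) * q ^ i) := by
  induction d with
  | zero => simp
  | succ d ih =>
    push_cast
    rw [← add_assoc, qPochZ_add_one, ih, Finset.prod_range_succ, mul_assoc,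
      ← zpow_natCast q d, ← zpow_add₀ q_ne_zero, add_right_comm z 1]

lemma qPochZ_reflect_zero (n : ℕ) :
    qPochZ (-q) (-n - 1) * qPochZ (-q) n = q ^ (n + 1).choose 2 / 2 := by
  induction n with
  | zero =>
    have h := qPochZ_add_one (-1)
    norm_num [qPochZ_zero] at h
    norm_num [qPochZ_zero]
    field_simp
    exact h.symm
  | succ n ih =>
    have h := qPochZ_add_one (-n - 1 - 1)
    rw [sub_add_cancel] at h
    have h2 := qPochZ_add_one n
    have h1 := one_add_q_zpow_ne_zero (-(n + 1))
    rw [show -(n : ℤ) - 1 = -(n + 1) by ring] at h ih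
    rw [h] at ih
    have h3 : 1 + q ^ ((n : ℤ) + 1) = q ^ (n + 1) * (1 + q ^ (-((n : ℤ) + 1))) := by
      rw [mul_add, ← zpow_natCast, ← zpow_add₀ q_ne_zero]
      push_cast
      rw [add_neg_cancel, zpow_zero]
      ring
    push_cast
    rw [h2, h3, q_pow_choose_two_succ (n + 1), mul_div_right_comm, ← ih]
    ring

lemma qPochZ_reflect (n s : ℕ) :
    qPochZ (-q) (s - n - 1) * qPochZ (-q) (n - s) =
      q ^ (n + 1).choose 2 / 2 * q ^ s.choose 2 * q ^ (-(n : ℤ) * s) := by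
  induction s with
  | zero => simpa using qPochZ_reflect_zero n
  | succ s ih =>
    have h1 := qPochZ_add_one (s - n - 1)
    have h2 := qPochZ_add_one (n - s - 1)
    rw [sub_add_cancel] at h1 h2
    rw [h2] at ih
    have h3 : 1 + q ^ ((s : ℤ) - n) = q ^ ((s : ℤ) - n) * (1 + q ^ ((n : ℤ) - s)) := by
      rw [mul_add, ← zpow_add₀ q_ne_zero, show (s : ℤ) - n + (n - s) = 0 by ring, zpow_zero]
      ring
    push_cast
    rw [show (s : ℤ) + 1 - n - 1 = s - n by ring, show (n : ℤ) - (s + 1) = n - s - 1 by ring,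
      h1, h3, q_pow_choose_two_succ s, show -(n : ℤ) * (s + 1) = -n * s - n by ring,
      zpow_sub₀ q_ne_zero (-(n : ℤ) * s), zpow_sub₀ q_ne_zero s, zpow_natCast, zpow_natCast]
    linear_combination (q ^ s / q ^ n) * ih

/-- Transformation of the sum over one index of the cyclic sum, multiplied by the neighbouring
`q`-Pochhammer symbol. -/
lemma qPochZ_mul_sum_qbinom (n r : ℕ) (t : ℤ) (hr : r < 2 * n + 2) :
    qPochZ (-q) (n - r) * ∑ s ∈ range (2 * n + 2), (-1) ^ s * q ^ s.choose 2 *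
        qPochZ (-q) (n - s) * qbinom (2 * n + 1 - r) s * qbinom (2 * n + 1 - s) t =
      q ^ (n + 1).choose 2 / 2 * ∑ m ∈ range (2 * n + 2), q ^ m.choose 2 *
        q ^ ((m : ℤ) * (n + 1 - t)) * qbinom (2 * n + 1 - r) m *
          qbinom (2 * n + 1 - m) (2 * n + 1 - t) := by
  obtain ⟨R, hR⟩ : ∃ R, r + R = 2 * n + 1 := ⟨2 * n + 1 - r, by omega⟩
  have hR' : (2 * n + 1 - r : ℤ) = R := by omega
  have key : ∀ s ∈ range (2 * n + 2), qPochZ (-q) (n - r) * ((-1) ^ s * q ^ s.choose 2 *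
        qPochZ (-q) (n - s) * qbinom R s * qbinom (2 * n + 1 - s) t) =
      ∑ m ∈ range (2 * n + 2), q ^ (n + 1).choose 2 / 2 * (q ^ m.choose 2 *
        q ^ (-(n : ℤ) * m) * qbinom R m) *
          ((-1) ^ s * q ^ s.choose 2 * qbinom m s * qbinom (2 * n + 1 - s) t) := by
    intro s _
    rcases le_or_gt s R with hs | hs
    · have h1 := qPochZ_add_natCast (s - n - 1) (R - s)
      rw [prod_one_add_mul_q_pow_shift _ hs (B := 2 * n + 2) (by omega), sub_add_cancel] at h1
      have h2 := qPochZ_reflect n s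
      rw [show (n : ℤ) - r = s - n - 1 + (R - s : ℕ) by omega, h1]
      calc _ = (qPochZ (-q) (s - n - 1) * qPochZ (-q) (n - s)) * ((-1) ^ s * q ^ s.choose 2 *
              qbinom R s * qbinom (2 * n + 1 - s) t) * ∑ m ∈ range (2 * n + 2),
                qbinom ((R : ℤ) - s) ((m : ℤ) - s) * q ^ (m - s).choose 2 *
                  (q ^ ((s : ℤ) - n)) ^ (m - s) := by ring
        _ = _ := by
          rw [h2, Finset.mul_sum]
          refine Finset.sum_congr rfl fun m _ => ?_
          have h3 := qbinom_mul_qbinom R m s hs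
          rcases lt_or_ge m s with hm | hm
          · rw [qbinom_of_lt (a := m) (b := s) (by omega),
              qbinom_of_neg (b := (m : ℤ) - s) (by omega)]
            ring
          · obtain ⟨i, rfl⟩ := Nat.exists_eq_add_of_le hm
            have h4 : q ^ (-(n : ℤ) * s) * (q ^ ((s : ℤ) - n)) ^ i =
                q ^ (s * i) * q ^ (-(n : ℤ) * (s + i : ℕ)) := by
              rw [← zpow_natCast, ← zpow_natCast, ← zpow_mul, ← zpow_add₀ q_ne_zero,
                ← zpow_add₀ q_ne_zero]
              congr 1; push_cast; ring
            rw [add_tsub_cancel_left, q_pow_choose_two_add s i]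
            linear_combination (q ^ (n + 1).choose 2 / 2 * (-1) ^ s * q ^ s.choose 2 *
              q ^ s.choose 2 * qbinom (2 * n + 1 - s) t * q ^ i.choose 2) *
              (q ^ (-(n : ℤ) * s) * (q ^ ((s : ℤ) - n)) ^ i * h3 +
                qbinom R (s + i : ℕ) * qbinom (s + i : ℕ) s * h4)
    · rw [qbinom_of_lt (a := R) (b := s) (by omega)]
      rw [Finset.sum_eq_zero]
      · ring
      · intro m _
        rcases lt_or_ge m s with hm | hm
        · rw [qbinom_of_lt (a := m) (b := s) (by omega)]; ring
        · rw [qbinom_of_lt (a := R) (b := m) (by omega)]; ring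
  rw [hR', Finset.mul_sum, Finset.sum_congr rfl key, Finset.sum_comm, Finset.mul_sum]
  refine Finset.sum_congr rfl fun m hm => ?_
  rw [Finset.mem_range] at hm
  rw [← Finset.mul_sum, sum_qbinom_mul_qbinom_sub t m _ (2 * n + 1) hm (by omega),
    show (m : ℤ) * (n + 1 - t) = -n * m + m * (2 * n + 1 - t) by ring, zpow_add₀ q_ne_zero]
  ring

lemma sum_qbinom_mul_qbinom_reflect (n t u : ℕ) (h : u + t = 2 * n + 1) :
    qPochZ (-q) (n - t) * ∑ m ∈ range (2 * n + 2), q ^ m.choose 2 *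
        q ^ ((m : ℤ) * (n + 1 - t)) * qbinom (2 * n + 1 - m) u *
          (q ^ ((u : ℤ) * (2 * n + 1 - m)) * qbinom t (2 * n + 1 - m)) =
      q ^ u.choose 2 * q ^ ((u : ℤ) * (n + 1)) * qbinom t u * qPochZ (-q) (n - u) := by
  have hb : ∀ m ∈ range (2 * n + 2), qbinom (2 * n + 1 - m) u * qbinom t (2 * n + 1 - m) =
      qbinom t u * qbinom ((t : ℤ) - u) (m - u) := by
    intro m hm
    rw [Finset.mem_range] at hm
    obtain ⟨i, hi⟩ : ∃ i, m + i = 2 * n + 1 := ⟨2 * n + 1 - m, by omega⟩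
    have hi' : (2 * n + 1 - m : ℤ) = i := by omega
    rw [hi']
    rcases le_or_gt u t with hu | hu
    · rw [mul_comm, ← qbinom_mul_qbinom t i u hu, ← qbinom_symm ((t : ℤ) - u)]
      congr 2
      omega
    · rw [qbinom_of_lt (a := t) (b := u) (by omega)]
      rcases lt_or_ge i u with hm | hm
      · rw [qbinom_of_lt (a := i) (b := u) (by omega)]; ring
      · rw [qbinom_of_lt (a := t) (b := i) (by omega)]; ring
  rcases le_or_gt u t with hu | hu
  · have h1 := qPochZ_add_natCast (u - n - 1) (t - u)
    rw [prod_one_add_mul_q_pow_shift _ hu (B := 2 * n + 2) (by omega), sub_add_cancel,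
      show (u : ℤ) - n - 1 + (t - u : ℕ) = n - u by omega,
      show (u : ℤ) - n - 1 = n - t by omega] at h1
    rw [h1, mul_left_comm (q ^ u.choose 2 * _ * _), Finset.mul_sum (a := q ^ u.choose 2 * _ * _)]
    congr 1
    refine Finset.sum_congr rfl fun m hm => ?_
    have h2 := hb m hm
    rcases lt_or_ge m u with hm | hm
    · rw [qbinom_of_neg (b := (m : ℤ) - u) (by omega)] at h2 ⊢
      linear_combination (q ^ m.choose 2 *
        q ^ ((m : ℤ) * (n + 1 - t)) * q ^ ((u : ℤ) * (2 * n + 1 - m))) * h2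
    · obtain ⟨i, rfl⟩ := Nat.exists_eq_add_of_le hm
      have h4 : q ^ (u * i) * q ^ (((u + i : ℕ) : ℤ) * (n + 1 - t)) *
          q ^ ((u : ℤ) * (2 * n + 1 - (u + i : ℕ))) =
          q ^ ((u : ℤ) * (n + 1)) * (q ^ ((u : ℤ) - n)) ^ i := by
        rw [← zpow_natCast, ← zpow_natCast, ← zpow_mul, ← zpow_add₀ q_ne_zero,
          ← zpow_add₀ q_ne_zero, ← zpow_add₀ q_ne_zero]
        congr 1
        have h5 : (t : ℤ) = 2 * n + 1 - u := by omega
        rw [h5]; push_cast; ring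
      rw [add_tsub_cancel_left, q_pow_choose_two_add]
      linear_combination (q ^ u.choose 2 * q ^ i.choose 2) * (
        q ^ (u * i) * q ^ (((u + i : ℕ) : ℤ) * (n + 1 - t)) *
          q ^ ((u : ℤ) * (2 * n + 1 - (u + i : ℕ))) * h2 +
        qbinom t u * qbinom ((t : ℤ) - u) ((u + i : ℕ) - u) * h4)
  · rw [Finset.sum_eq_zero]
    · rw [qbinom_of_lt (a := t) (b := u) (by omega)]; ring
    · intro m hm
      have h2 := hb m hm
      rw [qbinom_of_lt (a := t) (b := u) (by omega)] at h2
      linear_combination (q ^ m.choose 2 *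
        q ^ ((m : ℤ) * (n + 1 - t)) * q ^ ((u : ℤ) * (2 * n + 1 - m))) * h2

/-- The single sum to which the cyclic triple sum reduces. -/
noncomputable def reducedSum (n : ℕ) : RatFunc ℚ :=
  ∑ v ∈ range (n + 1), (-1) ^ v * q ^ ((v : ℤ) * (v - n)) * qbinom (n + 1 + v) (n - v) *
    qPochZ (-q) v

lemma sum_piFinset_fin_three {M : Type*} [AddCommMonoid M] (S : Finset ℕ) (f : (Fin 3 → ℕ) → M) :
    ∑ r ∈ Fintype.piFinset (fun _ : Fin 3 => S), f r =
      ∑ a ∈ S, ∑ b ∈ S, ∑ c ∈ S, f ![a, b, c] := by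
  simp_rw [← Finset.sum_product']
  refine Finset.sum_bij' (fun r _ => (r 0, r 1, r 2)) (fun p _ => ![p.1, p.2.1, p.2.2])
    ?_ ?_ ?_ ?_ ?_
  · intro r hr
    rw [Fintype.mem_piFinset] at hr
    simp [hr]
  · intro p hp
    simp only [Finset.mem_product] at hp
    rw [Fintype.mem_piFinset]
    intro i
    fin_cases i <;> simp [hp]
  · intro r _
    ext i
    fin_cases i <;> rfl
  · intro p _
    rfl
  · intro r _
    congr 1
    ext i
    fin_cases i <;> rfl

lemma Umul_three (n : ℕ) : Umul 3 n =
    q ^ (n + 1).choose 2 / 2 * q ^ (2 * n + 1).choose 2 * (-1) ^ (n + 1) * reducedSum n := by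
  have hsum : Umul 3 n = ∑ t ∈ range (2 * n + 2), ∑ r ∈ range (2 * n + 2),
      (-1) ^ t * q ^ t.choose 2 * qPochZ (-q) (n - t) * ((-1) ^ r * q ^ r.choose 2 *
        qbinom (2 * n + 1 - t) r) * (qPochZ (-q) (n - r) * ∑ s ∈ range (2 * n + 2),
          (-1) ^ s * q ^ s.choose 2 *
        qPochZ (-q) (n - s) * qbinom (2 * n + 1 - r) s * qbinom (2 * n + 1 - s) t) := by
    rw [Umul, sum_piFinset_fin_three, Finset.sum_comm (s := range (2 * n + 2))]
    refine Finset.sum_congr rfl fun r _ => ?_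
    rw [Finset.sum_comm]
    refine Finset.sum_congr rfl fun t _ => ?_
    rw [Finset.mul_sum, Finset.mul_sum]
    refine Finset.sum_congr rfl fun s _ => ?_
    simp only [Fin.prod_univ_three, ← Nat.choose_two_right, sub_add_eq_add_sub,
      Fin.isValue, zero_add, show (1 : Fin 3) + 1 = 2 from rfl, show (2 : Fin 3) + 1 = 0 from rfl,
      Matrix.cons_val]
    ring
  have hr : ∀ t ∈ range (2 * n + 2), ∑ r ∈ range (2 * n + 2),
      (-1) ^ t * q ^ t.choose 2 * qPochZ (-q) (n - t) * ((-1) ^ r * q ^ r.choose 2 *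
        qbinom (2 * n + 1 - t) r) * (qPochZ (-q) (n - r) * ∑ s ∈ range (2 * n + 2),
          (-1) ^ s * q ^ s.choose 2 *
        qPochZ (-q) (n - s) * qbinom (2 * n + 1 - r) s * qbinom (2 * n + 1 - s) t) =
      q ^ (n + 1).choose 2 / 2 * ((-1) ^ t * q ^ t.choose 2 * (q ^ (2 * n + 1 - t).choose 2 *
        q ^ (((2 * n + 1 - t : ℕ) : ℤ) * (n + 1)) * qbinom t (2 * n + 1 - t : ℕ) *
          qPochZ (-q) (n - (2 * n + 1 - t : ℕ)))) := by
    intro t ht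
    rw [Finset.mem_range] at ht
    obtain ⟨u, hu⟩ : ∃ u, u + t = 2 * n + 1 := ⟨2 * n + 1 - t, by omega⟩
    have hu' : (2 * n + 1 - t : ℤ) = u := by omega
    rw [show 2 * n + 1 - t = u by omega, ← sum_qbinom_mul_qbinom_reflect n t u hu]
    calc _ = ∑ r ∈ range (2 * n + 2), ∑ m ∈ range (2 * n + 2),
          q ^ (n + 1).choose 2 / 2 * ((-1) ^ t * q ^ t.choose 2 * (qPochZ (-q) (n - t) *
            (q ^ m.choose 2 * q ^ ((m : ℤ) * (n + 1 - t)) * qbinom (2 * n + 1 - m) u))) *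
          ((-1) ^ r * q ^ r.choose 2 * qbinom u r * qbinom (2 * n + 1 - r) m) := by
          refine Finset.sum_congr rfl fun r hr => ?_
          rw [qPochZ_mul_sum_qbinom n r t (Finset.mem_range.mp hr), Finset.mul_sum, Finset.mul_sum,
            hu']
          refine Finset.sum_congr rfl fun m _ => ?_
          ring
      _ = _ := by
          rw [Finset.sum_comm, Finset.mul_sum, Finset.mul_sum, Finset.mul_sum]
          refine Finset.sum_congr rfl fun m _ => ?_
          rw [← Finset.mul_sum, sum_qbinom_mul_qbinom_sub m u _ (2 * n + 1) (by omega) (by omega),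
            show (2 * n + 1 - u : ℤ) = t by omega]
          ring
  have hzero : ∑ t ∈ range (n + 1), (-1) ^ t * q ^ t.choose 2 * (q ^ (2 * n + 1 - t).choose 2 *
      q ^ (((2 * n + 1 - t : ℕ) : ℤ) * (n + 1)) * qbinom t (2 * n + 1 - t : ℕ) *
        qPochZ (-q) (n - (2 * n + 1 - t : ℕ))) = 0 := by
    refine Finset.sum_eq_zero fun t ht => ?_
    rw [Finset.mem_range] at ht
    rw [qbinom_of_lt (a := t) (by omega)]; ring
  rw [hsum, Finset.sum_congr rfl hr, ← Finset.mul_sum, show 2 * n + 2 = (n + 1) + (n + 1) by ring,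
    Finset.sum_range_add, hzero, zero_add, reducedSum, mul_assoc, mul_assoc]
  congr 1
  rw [Finset.mul_sum, Finset.mul_sum]
  refine Finset.sum_congr rfl fun v hv => ?_
  rw [Finset.mem_range] at hv
  obtain ⟨u, rfl⟩ : ∃ u, n = v + u := ⟨n - v, by omega⟩
  rw [show 2 * (v + u) + 1 - (v + u + 1 + v) = u by omega,
    show 2 * (v + u) + 1 = v + u + 1 + v + u by omega, q_pow_choose_two_add _ u]
  have h4 : q ^ (((u : ℕ) : ℤ) * ((v + u : ℕ) + 1)) =
      q ^ ((v + u + 1 + v) * u) * q ^ ((v : ℤ) * (v - (v + u : ℕ))) := by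
    rw [← zpow_natCast, ← zpow_add₀ q_ne_zero]
    congr 1; push_cast; ring
  rw [h4]
  push_cast
  rw [show (v : ℤ) + u - u = v by ring, show (v : ℤ) + u - v = u by ring]
  ring

/-- Creative telescoping for `reducedSum`. -/
lemma reducedSum_add_two (n : ℕ) :
    q ^ (n + 1) * reducedSum (n + 2) + reducedSum n = 0 := by
  let H : ℕ → RatFunc ℚ := fun v => -((-1) ^ v * q ^ (n + 1) * (1 + q ^ (n + 2)) *
    q ^ ((v : ℤ) * (v - n) - 2 * v) * qbinom (n + 1 + v) (n + 2 - v) * qPochZ (-q) (v - 1))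
  have h1 : reducedSum n = ∑ v ∈ range (n + 3), (-1) ^ v * q ^ ((v : ℤ) * (v - n)) *
      qbinom (n + 1 + v) (n - v) * qPochZ (-q) v := by
    rw [Finset.sum_range_succ, Finset.sum_range_succ, qbinom_of_neg (by push_cast; omega),
      qbinom_of_neg (by push_cast; omega), reducedSum]
    ring
  have h2 : ∀ v : ℕ, q ^ (n + 1) * ((-1) ^ v * q ^ ((v : ℤ) * (v - (n + 2 : ℕ))) *
      qbinom ((n + 2 : ℕ) + 1 + v) ((n + 2 : ℕ) - v) * qPochZ (-q) v) +
      (-1) ^ v * q ^ ((v : ℤ) * (v - n)) *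
        qbinom (n + 1 + v) (n - v) * qPochZ (-q) v = H (v + 1) - H v := by
    intro v
    have e1 := qbinom_natCast_left (n + v + 3) (n + 2 - v)
    have e2 := qbinom_natCast_left (n + v + 1) (n - v)
    have e3 := qbinom_natCast_left (n + v + 1) (n + 2 - v)
    have e4 := qbinom_natCast_left (n + v + 2) (n + 1 - v)
    have p := qPochZ_add_one (v - 1)
    have g1 := qPochInv_sub_one (n + 2 - v)
    have g2 := qPochInv_sub_one (n + 1 - v)
    have g3 := qPochInv_sub_one (2 * v + 1)
    have g4 := qPochInv_sub_one (2 * v)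
    rw [show (n + 2 - v - 1 : ℤ) = n + 1 - v by ring] at g1
    rw [show (n + 1 - v - 1 : ℤ) = n - v by ring] at g2
    rw [add_sub_cancel_right] at g3
    rw [sub_add_cancel] at p
    push_cast at e1 e2 e3 e4
    rw [show (n + v + 3 - (n + 2 - v) : ℤ) = 2 * v + 1 by ring, qPoch_q_succ, qPoch_q_succ] at e1
    rw [show (n + v + 1 - (n - v) : ℤ) = 2 * v + 1 by ring] at e2
    rw [show (n + v + 1 - (n + 2 - v) : ℤ) = 2 * v - 1 by ring] at e3
    rw [show (n + v + 2 - (n + 1 - v) : ℤ) = 2 * v + 1 by ring, qPoch_q_succ] at e4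
    simp only [H]
    push_cast
    rw [show (n + 2 + 1 + v : ℤ) = n + v + 3 by ring, show (n + 1 + v : ℤ) = n + v + 1 by ring,
      show (n + 1 + (v + 1) : ℤ) = n + v + 2 by ring, show (n + 2 - (v + 1) : ℤ) = n + 1 - v by ring,
      add_sub_cancel_right (v : ℤ), e1, e2, e3, e4, g4, g3, g2, g1, p]
    have z1 : q ^ ((v : ℤ) * (v - (n + 2))) = q ^ ((v : ℤ) * (v - n)) / (q ^ v) ^ 2 := by
      rw [← pow_mul, ← zpow_natCast, ← zpow_sub₀ q_ne_zero]; congr 1; push_cast; ring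
    have z2 : q ^ ((v : ℤ) * (v - n) - 2 * v) = q ^ ((v : ℤ) * (v - n)) / (q ^ v) ^ 2 := by
      rw [← pow_mul, ← zpow_natCast, ← zpow_sub₀ q_ne_zero]; congr 1; push_cast; ring
    have z3 : q ^ (((v : ℤ) + 1) * (v + 1 - n) - 2 * (v + 1)) =
        q ^ ((v : ℤ) * (v - n)) / (q * q ^ n) := by
      rw [← pow_succ', ← zpow_natCast, ← zpow_sub₀ q_ne_zero]; congr 1; push_cast; ring
    have z4 : q ^ (n + 2 - v : ℤ) = q ^ n * q ^ 2 / q ^ v := by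
      rw [← pow_add, ← zpow_natCast, ← zpow_natCast, ← zpow_sub₀ q_ne_zero]; push_cast; rfl
    have z5 : q ^ (n + 1 - v : ℤ) = q ^ n * q / q ^ v := by
      rw [← pow_succ, ← zpow_natCast, ← zpow_natCast, ← zpow_sub₀ q_ne_zero]; push_cast; rfl
    have z6 : q ^ (2 * v : ℤ) = (q ^ v) ^ 2 := by
      rw [← pow_mul, ← zpow_natCast]; congr 1; push_cast; ring
    have z7 : q ^ (2 * v + 1 : ℤ) = (q ^ v) ^ 2 * q := by
      rw [← pow_mul, ← pow_succ, ← zpow_natCast]; congr 1; push_cast; ring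
    rw [z1, z2, z3, z4, z5, z6, z7, zpow_natCast]
    simp only [pow_add]
    have hq := q_ne_zero
    have hx := pow_ne_zero n q_ne_zero
    have hy := pow_ne_zero v q_ne_zero
    generalize q ^ n = x at *
    generalize q ^ v = y at *
    generalize q ^ ((v : ℤ) * (v - n)) = e at *
    field_simp
    ring
  have h3 := Finset.sum_range_sub H (n + 3)
  rw [reducedSum, h1, Finset.mul_sum, ← Finset.sum_add_distrib, Finset.sum_congr rfl fun v _ => h2 v,
    h3]
  simp only [H]
  rw [qbinom_of_neg (by push_cast; omega), qbinom_of_lt (by push_cast; omega)]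
  ring

lemma reducedSum_even (k : ℕ) : reducedSum (2 * k) = (-1) ^ k * q ^ (-(k : ℤ) ^ 2) := by
  induction k with
  | zero =>
    have := one_sub_q_pow_ne_zero one_pos
    simp [reducedSum, qPochZ_zero]
    simp_all [qbinom, qPoch]
  | succ k ih =>
    have h := reducedSum_add_two (2 * k)
    have hz : q ^ (-(k : ℤ) ^ 2) = q ^ (2 * k + 1) * q ^ (-((k + 1 : ℕ) : ℤ) ^ 2) := by
      rw [← zpow_natCast, ← zpow_add₀ q_ne_zero]; congr 1; push_cast; ring
    have hq := pow_ne_zero (2 * k + 1) q_ne_zero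
    rw [ih, hz] at h
    apply mul_left_cancel₀ hq
    rw [mul_add_one, pow_succ]
    linear_combination h

lemma reducedSum_odd (k : ℕ) : reducedSum (2 * k + 1) = 0 := by
  induction k with
  | zero =>
    have h1 := one_sub_q_pow_ne_zero one_pos
    have h2 := one_sub_q_pow_ne_zero two_pos
    have h3 := qPochZ_add_one 0
    norm_num [qPochZ_zero] at h3
    norm_num [reducedSum, Finset.sum_range_succ, qPochZ_zero, h3]
    norm_num [qbinom, qPoch, Finset.prod_range_succ, show Int.toNat 2 = 2 from rfl,
      show Int.toNat 3 = 3 from rfl]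
    rw [pow_one] at h1
    have h4 : 1 - q * q ≠ 0 := by rwa [← sq]
    have h5 : 1 - q ^ 3 ≠ 0 := one_sub_q_pow_ne_zero three_pos
    rw [← pow_succ', div_self (mul_ne_zero (mul_ne_zero h1 h4) h5)]
    field_simp
    ring
  | succ k ih =>
    have h := reducedSum_add_two (2 * k + 1)
    rw [ih, add_zero] at h
    exact (mul_eq_zero.mp h).resolve_left (pow_ne_zero _ q_ne_zero)

/-- Theorem 3.1 (second part): `U_3(n) = 0` if `n = 2k-1` and
`U_3(n) = ((-1)^(k-1)/2) q^(9k²+3k)` if `n = 2k`. -/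
theorem U3_eval (n : ℕ) (hn : 1 ≤ n) (k : ℕ) :
    ((n : ℤ) = 2 * k - 1 → Umul 3 n = 0) ∧
    ((n : ℤ) = 2 * k →
      Umul 3 n = (-1 : RatFunc ℚ) ^ ((k : ℤ) - 1) / 2 * q ^ (9 * (k : ℤ) ^ 2 + 3 * k)) := by
  constructor
  · intro h
    obtain ⟨j, rfl⟩ : ∃ j, n = 2 * j + 1 := ⟨k - 1, by omega⟩
    rw [Umul_three, reducedSum_odd, mul_zero]
  · intro h
    obtain rfl : n = 2 * k := by omega
    have h1 : (2 * k + 1).choose 2 = k * (2 * k + 1) := by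
      rw [Nat.choose_two_right, Nat.add_sub_cancel, mul_comm, mul_assoc,
        Nat.mul_div_cancel_left _ two_pos]
    have h2 : (2 * (2 * k) + 1).choose 2 = 2 * k * (2 * (2 * k) + 1) := by
      rw [Nat.choose_two_right, Nat.add_sub_cancel, mul_comm, mul_assoc,
        Nat.mul_div_cancel_left _ two_pos, mul_assoc]
    have h3 : q ^ (9 * (k : ℤ) ^ 2 + 3 * k) = q ^ (k * (2 * k + 1)) *
        q ^ (2 * k * (2 * (2 * k) + 1)) * q ^ (-(k : ℤ) ^ 2) := by
      rw [← zpow_natCast, ← zpow_natCast, ← zpow_add₀ q_ne_zero, ← zpow_add₀ q_ne_zero]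
      congr 1; push_cast; ring
    rw [Umul_three, reducedSum_even, h1, h2, h3, zpow_sub₀ (by norm_num), zpow_natCast, pow_succ,
      pow_mul]
    norm_num
    ring
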